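/- Let n ≥ 2, 0 < q < n, and K ≥ 1. Let f : B → ℝⁿ \ {0} be a K-quasiregular mapping satisfying the Miniowitz growth estimate C₀^{-1}((1−|y|)/(1+|y|))^α ≤ |f(y)|/|f(0)| ≤ C₀((1+|y|)/(1−|y|))^α for all y ∈ B (with constants C₀ ≥ 1, α > 0), and the multiplicity bound N(f, B(0,r)) ≤ C₁/(1−r)^a for all 0 < r < 1, where 0 ≤ a < n−1. Then ∫_B (‖Df(x)‖/|f(x)|)^q (1−|x|)^{q−1} dx ≤ c, where the constant c depends only on a, C₀, C₁, K, α, n and q. -/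

import Mathlib

open MeasureTheory Metric Set Filter
open scoped ENNReal NNReal Topology Classical

noncomputable section

abbrev Vec (n : ℕ) := EuclideanSpace ℝ (Fin n)

/-- The open unit ball in `ℝⁿ`. -/
def unitBall (n : ℕ) : Set (Vec n) := Metric.ball 0 1

/-- The unit sphere `S^{n-1}` in `ℝⁿ`. -/
def unitSphere (n : ℕ) : Set (Vec n) := Metric.sphere 0 1

/-- Surface measure on the unit sphere, modelled by `(n-1)`-dimensional
Hausdorff measure restricted to the sphere. -/
def sphMeasure (n : ℕ) : Measure (Vec n) := (μH[(n : ℝ) - 1]).restrict (unitSphere n)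

/-- `f` is `K`-quasiregular on the unit ball. -/
def IsQR (n : ℕ) (K : ℝ) (f : Vec n → Vec n) : Prop :=
  ContinuousOn f (unitBall n) ∧
  (∀ x ∈ unitBall n, DifferentiableAt ℝ f x) ∧
  (∀ᵐ x ∂(volume.restrict (unitBall n)),
    ‖fderiv ℝ f x‖ ^ n ≤ K * (fderiv ℝ f x).det)

/-- The conformal automorphism `T_x` of the unit ball (with `T_0 = id`). -/
def mobiusT (n : ℕ) (x : Vec n) (y : Vec n) : Vec n :=
  if x = 0 then y
  else (‖x‖ ^ 2 * ‖y - (‖x‖ ^ 2)⁻¹ • x‖ ^ 2)⁻¹ •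
    ((1 - ‖x‖ ^ 2) • (y - x) - ‖y - x‖ ^ 2 • x)

/-- The Miniowitz class (Min) with constants `C₀, α`. -/
def InMiniowitz (n : ℕ) (C₀ α : ℝ) (f : Vec n → Vec n) : Prop :=
  ∀ x ∈ unitBall n, ∀ y ∈ unitBall n,
    C₀⁻¹ * ((1 - ‖y‖) / (1 + ‖y‖)) ^ α ≤ ‖f (mobiusT n (-x) y)‖ / ‖f (mobiusT n (-x) 0)‖ ∧
    ‖f (mobiusT n (-x) y)‖ / ‖f (mobiusT n (-x) 0)‖ ≤ C₀ * ((1 + ‖y‖) / (1 - ‖y‖)) ^ α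

/-- The multiplicity condition (M) with exponent `a` and constant `C₁`. -/
def MultCond (n : ℕ) (a C₁ : ℝ) (f : Vec n → Vec n) : Prop :=
  ∀ x ∈ unitBall n, ∀ r : ℝ, 0 < r → r < 1 → ∀ y : Vec n,
    (({z ∈ Metric.ball (0 : Vec n) r | f (mobiusT n (-x) z) = y}).encard : ℝ≥0∞) ≤
      ENNReal.ofReal (C₁ / (1 - r) ^ a)

/-- The non-tangential region `Γ(ω)` with aperture parameter `κ`. -/
def ntRegion (n : ℕ) (κ : ℝ) (ω : Vec n) : Set (Vec n) :=
  {x ∈ unitBall n | ‖x - ω‖ < (1 + κ) * (1 - ‖x‖)}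

/-- The non-tangential maximal function `f*`. -/
def ntMax (n : ℕ) (κ : ℝ) (f : Vec n → Vec n) (ω : Vec n) : ℝ≥0∞ :=
  ⨆ x ∈ ntRegion n κ ω, ENNReal.ofReal ‖f x‖

/-- `f` has the non-tangential limit `L` at `ω`. -/
def HasNTLimit (n : ℕ) (κ : ℝ) (f : Vec n → Vec n) (ω L : Vec n) : Prop :=
  Filter.Tendsto f (𝓝[ntRegion n κ ω] ω) (𝓝 L)

/-- The `p`-th mean of `f` on the sphere of radius `r`. -/
def hardyMean (n : ℕ) (p : ℝ) (f : Vec n → Vec n) (r : ℝ) : ℝ≥0∞ :=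
  (sphMeasure n (unitSphere n))⁻¹ *
    ∫⁻ ω, ENNReal.ofReal (‖f (r • ω)‖ ^ p) ∂(sphMeasure n)

/-- The Hardy `H^p` norm of `f` on the unit ball. -/
def hardyNorm (n : ℕ) (p : ℝ) (f : Vec n → Vec n) : ℝ≥0∞ :=
  (⨆ r ∈ Set.Ioo (0 : ℝ) 1, hardyMean n p f r) ^ (1 / p)

/-- `f` belongs to the Hardy space `H^p`. -/
def MemHp (n : ℕ) (p : ℝ) (f : Vec n → Vec n) : Prop := hardyNorm n p f < ⊤

/-- The `L^p(σ)` norm of a boundary function on the unit sphere. -/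
def lpSphere (n : ℕ) (p : ℝ) (g : Vec n → Vec n) : ℝ≥0∞ :=
  (∫⁻ ω, ENNReal.ofReal (‖g ω‖ ^ p) ∂(sphMeasure n)) ^ (1 / p)

/-- The `L^p(σ)` norm of the non-tangential maximal function `f*`. -/
def ntMaxLp (n : ℕ) (κ p : ℝ) (f : Vec n → Vec n) : ℝ≥0∞ :=
  (∫⁻ ω, (ntMax n κ f ω) ^ p ∂(sphMeasure n)) ^ (1 / p)

/-- `μ` is a Carleson measure on the unit ball with constant `c`. -/
def IsCarleson (n : ℕ) (c : ℝ) (μ : Measure (Vec n)) : Prop :=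
  ∀ ω ∈ unitSphere n, ∀ r : ℝ, 0 < r →
    μ (unitBall n ∩ Metric.ball ω r) ≤ ENNReal.ofReal c * ENNReal.ofReal r ^ ((n : ℝ) - 1)

/-- `μ` is an `α`-Carleson measure on the unit ball with constant `γ`. -/
def IsAlphaCarleson (n : ℕ) (α γ : ℝ) (μ : Measure (Vec n)) : Prop :=
  ∀ ω ∈ unitSphere n, ∀ r : ℝ, 0 < r →
    μ (unitBall n ∩ Metric.ball ω r) ≤
      ENNReal.ofReal γ * ENNReal.ofReal r ^ (α * ((n : ℝ) - 1))

section Area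

variable {E : Type*} [NormedAddCommGroup E] [NormedSpace ℝ E] [FiniteDimensional ℝ E]
  [MeasurableSpace E] [BorelSpace E]

/-- A set on which a map has nonvanishing Jacobian splits into countably many measurable pieces
on each of which the map is injective. -/
theorem exists_partition_injOn_of_det_ne_zero {f : E → E} {f' : E → E →L[ℝ] E} {s : Set E}
    (hf' : ∀ x ∈ s, HasFDerivWithinAt f (f' x) s x) (hdet : ∀ x ∈ s, (f' x).det ≠ 0) :
    ∃ t : ℕ → Set E, Pairwise (Function.onFun Disjoint t) ∧ (∀ k, MeasurableSet (t k)) ∧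
      s ⊆ (⋃ k, t k) ∧ ∀ k, InjOn f (s ∩ t k) := by
  have key : ∀ A : E →L[ℝ] E, ∃ δ : ℝ≥0, δ ≠ 0 ∧
      (A.det ≠ 0 → ∀ u, ApproximatesLinearOn f A u δ → InjOn f u) := by
    intro A
    by_cases hA : A.det = 0
    · exact ⟨1, one_ne_zero, fun h => absurd hA h⟩
    let B := A.toContinuousLinearEquivOfDetNeZero hA
    rcases B.subsingleton_or_nnnorm_symm_pos with hE | hpos
    · exact ⟨1, one_ne_zero, fun _ u _ x _ y _ _ => Subsingleton.elim x y⟩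
    · refine ⟨‖(B.symm : E →L[ℝ] E)‖₊⁻¹ / 2, ?_, fun _ u hu => ?_⟩
      · have : 0 < ‖(B.symm : E →L[ℝ] E)‖₊⁻¹ := inv_pos.2 hpos
        positivity
      · exact ApproximatesLinearOn.injOn (f' := B) hu
          (Or.inr (half_lt_self (inv_pos.2 hpos)))
  choose r hr hinj using key
  obtain ⟨t, A, hdisj, hmeas, hcov, happ, hA⟩ :=
    exists_partition_approximatesLinearOn_of_hasFDerivWithinAt f s f' hf' r hr
  refine ⟨t, hdisj, hmeas, hcov, fun k => ?_⟩
  rcases s.eq_empty_or_nonempty with rfl | hs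
  · simp
  · obtain ⟨y, hy, hAy⟩ := hA hs k
    exact hinj (A k) (hAy ▸ hdet y hy) _ (happ k)

/-- The number of pieces of a disjoint family whose image contains `y` is at most the number of
preimages of `y`. -/
theorem tsum_indicator_image_le_encard {α β : Type*} {f : α → β} {s : Set α} {t : ℕ → Set α}
    (ht : Pairwise (Function.onFun Disjoint t)) (y : β) :
    ∑' k, (f '' (s ∩ t k)).indicator (1 : β → ℝ≥0∞) y ≤
      (({z ∈ s | f z = y}).encard : ℝ≥0∞) := by
  set I : Set ℕ := {k | y ∈ f '' (s ∩ t k)} with hI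
  have h1 : ∑' k, (f '' (s ∩ t k)).indicator (1 : β → ℝ≥0∞) y = (I.encard : ℝ≥0∞) := by
    rw [← ENNReal.tsum_set_one, tsum_subtype I (fun _ => (1 : ℝ≥0∞))]
    rfl
  rw [h1]
  have : ∀ k : I, ∃ z, z ∈ s ∩ t k ∧ f z = y := fun k => k.2
  choose g hg hgy using this
  have hle : I.encard ≤ ({z ∈ s | f z = y}).encard := by
    let e : I ↪ {z ∈ s | f z = y} :=
      ⟨fun k => ⟨g k, (hg k).1, hgy k⟩, fun k l hkl => by
        have hkl' : g k = g l := congrArg Subtype.val hkl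
        by_contra hne
        exact Set.disjoint_left.1 (ht (fun h => hne (Subtype.ext h))) (hg k).2
          (hkl' ▸ (hg l).2)⟩
    exact e.encard_le
  exact_mod_cast hle

/-- Area inequality with multiplicity for everywhere differentiable maps. -/
theorem lintegral_abs_det_fderiv_mul_le (μ : Measure E) [μ.IsAddHaarMeasure]
    {f : E → E} {s : Set E} (hs : MeasurableSet s) (hf : ∀ x ∈ s, DifferentiableAt ℝ f x)
    {N : ℝ≥0∞} (hN : ∀ y, (({z ∈ s | f z = y}).encard : ℝ≥0∞) ≤ N)
    {u : E → ℝ≥0∞} (hu : Measurable u) {v : Set E} (hv : MeasurableSet v) (hfv : MapsTo f s v) :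
    ∫⁻ x in s, ENNReal.ofReal |(fderiv ℝ f x).det| * u (f x) ∂μ ≤ N * ∫⁻ y in v, u y ∂μ := by
  have hdetm : Measurable fun x => (fderiv ℝ f x).det :=
    ContinuousLinearMap.continuous_det.measurable.comp (measurable_fderiv ℝ f)
  set s' := s ∩ {x | (fderiv ℝ f x).det ≠ 0} with hs'
  have hs'm : MeasurableSet s' := hs.inter (hdetm (measurableSet_singleton 0).compl)
  have hf' : ∀ x ∈ s', HasFDerivWithinAt f (fderiv ℝ f x) s' x := fun x hx =>
    (hf x hx.1).hasFDerivAt.hasFDerivWithinAt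
  obtain ⟨t, hdisj, hmeas, hcov, hinj⟩ :=
    exists_partition_injOn_of_det_ne_zero hf' (fun x hx => hx.2)
  have hpiece : ∀ k, MeasurableSet (s' ∩ t k) := fun k => hs'm.inter (hmeas k)
  have hder : ∀ k, ∀ x ∈ s' ∩ t k, HasFDerivWithinAt f (fderiv ℝ f x) (s' ∩ t k) x :=
    fun k x hx => (hf' x hx.1).mono inter_subset_left
  have himg : ∀ k, MeasurableSet (f '' (s' ∩ t k)) := fun k =>
    measurable_image_of_fderivWithin (hpiece k) (hder k) (hinj k)
  have hsplit : s' = ⋃ k, s' ∩ t k := by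
    rw [← inter_iUnion, inter_eq_left.2 hcov]
  calc ∫⁻ x in s, ENNReal.ofReal |(fderiv ℝ f x).det| * u (f x) ∂μ
      = ∫⁻ x in s', ENNReal.ofReal |(fderiv ℝ f x).det| * u (f x) ∂μ := by
        rw [← lintegral_indicator hs, ← lintegral_indicator hs'm]
        congr 1 with x
        by_cases hx : x ∈ s <;> by_cases hd : (fderiv ℝ f x).det = 0 <;>
          simp [indicator, hs', hx, hd]
    _ = ∑' k, ∫⁻ x in s' ∩ t k, ENNReal.ofReal |(fderiv ℝ f x).det| * u (f x) ∂μ := by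
        conv_lhs => rw [hsplit]
        exact lintegral_iUnion hpiece
          (fun i j hij => (hdisj hij).mono inter_subset_right inter_subset_right) _
    _ = ∑' k, ∫⁻ y, (f '' (s' ∩ t k)).indicator u y ∂μ := by
        congr 1 with k
        rw [lintegral_indicator (himg k),
          lintegral_image_eq_lintegral_abs_det_fderiv_mul μ (hpiece k) (hder k) (hinj k)]
    _ = ∫⁻ y, ∑' k, (f '' (s' ∩ t k)).indicator u y ∂μ :=
        (lintegral_tsum fun k => (hu.indicator (himg k)).aemeasurable).symm
    _ ≤ ∫⁻ y, v.indicator (fun y => N * u y) y ∂μ := by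
        refine lintegral_mono fun y => ?_
        by_cases hy : y ∈ v
        · have : ∀ k, (f '' (s' ∩ t k)).indicator u y =
              (f '' (s' ∩ t k)).indicator (1 : E → ℝ≥0∞) y * u y := fun k => by
            by_cases hk : y ∈ f '' (s' ∩ t k) <;> simp [indicator, hk]
          simp only [this, ENNReal.tsum_mul_right, indicator_of_mem hy]
          gcongr
          refine (tsum_indicator_image_le_encard hdisj y).trans (le_trans ?_ (hN y))
          have : ({z ∈ s' | f z = y}).encard ≤ ({z ∈ s | f z = y}).encard :=
            encard_le_encard fun z hz => ⟨hz.1.1, hz.2⟩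
          exact_mod_cast this
        · have : ∀ k, y ∉ f '' (s' ∩ t k) := by
            rintro k ⟨x, hx, rfl⟩
            exact hy (hfv hx.1.1)
          simp [this]
    _ = N * ∫⁻ y in v, u y ∂μ := by
        rw [lintegral_indicator hv, lintegral_const_mul _ hu]

end Area

/-- Logarithmic growth of `∫ |y|⁻ⁿ` over spherical annuli. -/
theorem lintegral_inv_norm_pow_annulus (n : ℕ) (hn : 1 ≤ n) {m M : ℝ} (hm : 0 < m) (hmM : m ≤ M) :
    ∫⁻ y in {y : Vec n | ‖y‖ ∈ Icc m M}, ENNReal.ofReal ((‖y‖ ^ n)⁻¹) =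
      ENNReal.ofReal (n * volume.real (ball (0 : Vec n) 1) * Real.log (M / m)) := by
  have : NeZero n := ⟨by omega⟩
  have : Nontrivial (Vec n) := by infer_instance
  set φ : ℝ → ℝ := (Icc m M).indicator fun t => (t ^ n)⁻¹ with hφ
  have hsub : Icc m M ⊆ Ioi 0 := fun t ht => hm.trans_le ht.1
  have hmul : (fun y : ℝ => y ^ (Module.finrank ℝ (Vec n) - 1) • φ y) =
      (Icc m M).indicator fun t => t⁻¹ := by
    ext t
    by_cases ht : t ∈ Icc m M
    · have ht0 : t ≠ 0 := (hsub ht).ne'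
      obtain ⟨k, rfl⟩ : ∃ k, n = k + 1 := ⟨n - 1, by omega⟩
      simp only [hφ, indicator_of_mem ht, finrank_euclideanSpace, Fintype.card_fin, smul_eq_mul,
        Nat.add_sub_cancel]
      rw [pow_succ]
      field_simp
    · simp [hφ, indicator_of_notMem ht]
  have hcont : ContinuousOn (fun t : ℝ => t⁻¹) (Icc m M) :=
    continuousOn_inv₀.mono fun t ht => (hsub ht).ne'
  have hint : IntegrableOn (fun t : ℝ => t⁻¹) (Icc m M) := hcont.integrableOn_Icc
  have hφint : Integrable (fun y : Vec n => φ ‖y‖) := by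
    rw [integrable_fun_norm_addHaar, hmul]
    exact (hint.integrable_indicator measurableSet_Icc).integrableOn
  have hset : MeasurableSet {y : Vec n | ‖y‖ ∈ Icc m M} := measurable_norm measurableSet_Icc
  calc ∫⁻ y in {y : Vec n | ‖y‖ ∈ Icc m M}, ENNReal.ofReal ((‖y‖ ^ n)⁻¹)
      = ∫⁻ y : Vec n, ENNReal.ofReal (φ ‖y‖) := by
        rw [← lintegral_indicator hset]
        congr 1 with y
        by_cases hy : ‖y‖ ∈ Icc m M
        · rw [indicator_of_mem (show y ∈ {y : Vec n | ‖y‖ ∈ Icc m M} from hy), hφ,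
            indicator_of_mem hy]
        · rw [indicator_of_notMem (show y ∉ {y : Vec n | ‖y‖ ∈ Icc m M} from hy), hφ,
            indicator_of_notMem hy, ENNReal.ofReal_zero]
    _ = ENNReal.ofReal (∫ y : Vec n, φ ‖y‖) :=
        (ofReal_integral_eq_lintegral_ofReal hφint (ae_of_all _ fun y =>
          indicator_nonneg (fun t ht => inv_nonneg.2 (pow_nonneg (hsub ht).le n)) _)).symm
    _ = _ := by
        rw [integral_fun_norm_addHaar, hmul, setIntegral_indicator measurableSet_Icc,
          inter_eq_right.2 hsub, integral_Icc_eq_integral_Ioc,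
          ← intervalIntegral.integral_of_le hmM, integral_inv_of_pos hm (hm.trans_le hmM)]
        simp [mul_assoc]

/-- A negative power, greater than `-1`, of the distance to the boundary is integrable on the
unit ball. -/
theorem integrableOn_one_sub_norm_rpow (n : ℕ) (hn : 1 ≤ n) {β : ℝ} (hβ : -1 < β) :
    IntegrableOn (fun x : Vec n => (1 - ‖x‖) ^ β) (ball 0 1) := by
  have : NeZero n := ⟨by omega⟩
  have : Nontrivial (Vec n) := by infer_instance
  rw [integrableOn_fun_norm_addHaar volume (f := fun t : ℝ => (1 - t) ^ β)]
  have h1 : IntegrableOn (fun t : ℝ => (1 - t) ^ β) (Ioo 0 1) := by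
    have h := (intervalIntegral.intervalIntegrable_rpow' (a := 0) (b := 1) hβ).comp_sub_left 1
    simp only [sub_zero, sub_self] at h
    exact ((intervalIntegrable_iff_integrableOn_Ioo_of_le zero_le_one).1 h.symm)
  refine h1.bdd_mul (c := 1) (by fun_prop) ?_
  filter_upwards [ae_restrict_mem measurableSet_Ioo] with t ht
  rw [Real.norm_of_nonneg (pow_nonneg ht.1.le _)]
  exact pow_le_one₀ ht.1.le ht.2.le

/-- Polynomial growth of order `b` of the integrals over concentric balls makes the integral
against the power `s > b` of the distance to the boundary finite. -/
theorem lintegral_mul_one_sub_norm_rpow_le {E : Type*} [NormedAddCommGroup E] [MeasurableSpace E]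
    [BorelSpace E] (μ : Measure E) {h : E → ℝ≥0∞} {C b s : ℝ} (hC : 0 ≤ C) (hs : 0 ≤ s)
    (hbs : b < s)
    (hh : ∀ r : ℝ, 0 < r → r < 1 →
      ∫⁻ x in ball (0 : E) r, h x ∂μ ≤ ENNReal.ofReal (C * (1 - r) ^ (-b))) :
    ∫⁻ x in ball (0 : E) 1, h x * ENNReal.ofReal ((1 - ‖x‖) ^ s) ∂μ ≤
      ENNReal.ofReal (C * 2 ^ b * (1 - 2 ^ (b - s))⁻¹) := by
  set A : ℕ → Set E := fun j => ball 0 (1 - (1 / 2) ^ (j + 1)) ∩ {x | 1 - ‖x‖ ≤ (1 / 2) ^ j}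
  have hA : ∀ j, MeasurableSet (A j) := fun j =>
    measurableSet_ball.inter (measurableSet_le (by fun_prop) measurable_const)
  have hsub : ball (0 : E) 1 ⊆ ⋃ j, A j := by
    intro x hx
    rw [mem_ball_zero_iff] at hx
    obtain ⟨j, hj1, hj2⟩ := exists_nat_pow_near_of_lt_one (x := 1 - ‖x‖) (y := (1 / 2 : ℝ))
      (by linarith) (by linarith [norm_nonneg x]) (by norm_num) (by norm_num)
    refine mem_iUnion.2 ⟨j, ?_, hj2⟩
    rw [mem_ball_zero_iff]
    linarith
  have hpow : ∀ (j : ℕ) (c : ℝ), ((1 / 2 : ℝ) ^ j) ^ c = (2 ^ (-c)) ^ j := fun j c => by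
    rw [one_div, inv_pow, Real.inv_rpow (by positivity), ← Real.rpow_neg (by positivity),
      ← Real.rpow_natCast, ← Real.rpow_natCast, ← Real.rpow_mul (by norm_num),
      ← Real.rpow_mul (by norm_num), mul_comm]
  have hpiece : ∀ j, ∫⁻ x in A j, h x * ENNReal.ofReal ((1 - ‖x‖) ^ s) ∂μ ≤
      ENNReal.ofReal (C * 2 ^ b * (2 ^ (b - s)) ^ j) := by
    intro j
    have hlt : (1 / 2 : ℝ) ^ (j + 1) < 1 := pow_lt_one₀ (by norm_num) (by norm_num) (by omega)
    calc ∫⁻ x in A j, h x * ENNReal.ofReal ((1 - ‖x‖) ^ s) ∂μ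
        ≤ ∫⁻ x in A j, h x * ENNReal.ofReal (((1 / 2) ^ j) ^ s) ∂μ := by
          refine setLIntegral_mono' (hA j) fun x hx => ?_
          gcongr
          · have := mem_ball_zero_iff.1 hx.1
            linarith [show (0 : ℝ) < (1 / 2) ^ (j + 1) by positivity]
          · exact hx.2
      _ = (∫⁻ x in A j, h x ∂μ) * ENNReal.ofReal (((1 / 2) ^ j) ^ s) :=
          lintegral_mul_const' _ _ ENNReal.ofReal_ne_top
      _ ≤ ENNReal.ofReal (C * (1 - (1 - (1 / 2) ^ (j + 1))) ^ (-b)) *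
            ENNReal.ofReal (((1 / 2) ^ j) ^ s) := by
          gcongr
          exact (lintegral_mono_set inter_subset_left).trans
            (hh _ (by linarith) (by linarith [show (0 : ℝ) < (1 / 2) ^ (j + 1) by positivity]))
      _ = ENNReal.ofReal (C * 2 ^ b * (2 ^ (b - s)) ^ j) := by
          rw [← ENNReal.ofReal_mul' (by positivity), sub_sub_cancel, hpow, hpow, neg_neg,
            sub_eq_add_neg, Real.rpow_add (by norm_num), mul_pow]
          ring_nf
  have hq : (2 : ℝ) ^ (b - s) < 1 := Real.rpow_lt_one_of_one_lt_of_neg (by norm_num) (by linarith)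
  calc ∫⁻ x in ball (0 : E) 1, h x * ENNReal.ofReal ((1 - ‖x‖) ^ s) ∂μ
      ≤ ∑' j, ∫⁻ x in A j, h x * ENNReal.ofReal ((1 - ‖x‖) ^ s) ∂μ :=
        (lintegral_mono_set hsub).trans (lintegral_iUnion_le _ _)
    _ ≤ ∑' j : ℕ, ENNReal.ofReal (C * 2 ^ b * (2 ^ (b - s)) ^ j) := ENNReal.tsum_le_tsum hpiece
    _ = ENNReal.ofReal (C * 2 ^ b * (1 - 2 ^ (b - s))⁻¹) := by
        rw [← ENNReal.ofReal_tsum_of_nonneg (fun j => by positivity)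
          ((summable_geometric_of_lt_one (by positivity) hq).mul_left _), tsum_mul_left,
          tsum_geometric_of_lt_one (by positivity) hq]

/-- Growth of the logarithmic `n`-energy of a nonvanishing quasiregular map on concentric balls,
under two-sided growth and multiplicity bounds. -/
theorem IsQR.lintegral_log_energy_le {n : ℕ} (hn : 1 ≤ n) {K C₀ α a C₁ b : ℝ} (hK : 0 ≤ K)
    (hC₀ : 1 ≤ C₀) (hα : 0 ≤ α) (hC₁ : 0 ≤ C₁) (hab : a < b) {f : Vec n → Vec n}
    (hf : IsQR n K f) (h0 : f 0 ≠ 0)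
    (hmin : ∀ y ∈ unitBall n,
      C₀⁻¹ * ((1 - ‖y‖) / (1 + ‖y‖)) ^ α ≤ ‖f y‖ / ‖f 0‖ ∧
      ‖f y‖ / ‖f 0‖ ≤ C₀ * ((1 + ‖y‖) / (1 - ‖y‖)) ^ α)
    (hmult : ∀ r : ℝ, 0 < r → r < 1 → ∀ y : Vec n,
      (({z ∈ Metric.ball (0 : Vec n) r | f z = y}).encard : ℝ≥0∞) ≤
        ENNReal.ofReal (C₁ / (1 - r) ^ a)) {r : ℝ} (hr0 : 0 < r) (hr1 : r < 1) :
    ∫⁻ x in ball (0 : Vec n) r, ENNReal.ofReal ((‖fderiv ℝ f x‖ / ‖f x‖) ^ n) ≤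
      ENNReal.ofReal (K * C₁ * (n * volume.real (ball (0 : Vec n) 1)) *
        (2 * Real.log C₀ + 2 * α * (2 ^ (b - a) / (b - a))) * (1 - r) ^ (-b)) := by
  have hδ : 0 < 1 - r := by linarith
  have hf0 : 0 < ‖f 0‖ := norm_pos_iff.2 h0
  have hC₀' : 0 < C₀ := by linarith
  set X : ℝ := 2 / (1 - r) with hX
  have hX1 : 1 ≤ X := by rw [hX, le_div_iff₀ hδ]; linarith
  have hX0 : 0 < X := by linarith
  set M : ℝ := ‖f 0‖ * (C₀ * X ^ α) with hM
  set m : ℝ := ‖f 0‖ * (C₀⁻¹ * X⁻¹ ^ α) with hm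
  have hm0 : 0 < m := by positivity
  have hsub : ball (0 : Vec n) r ⊆ unitBall n := ball_subset_ball hr1.le
  have hmaps : MapsTo f (ball 0 r) {y | ‖y‖ ∈ Icc m M} := by
    intro x hx
    have hxr : ‖x‖ < r := mem_ball_zero_iff.1 hx
    have hx0 := norm_nonneg x
    obtain ⟨h1, h2⟩ := hmin x (hsub hx)
    rw [le_div_iff₀' hf0] at h1
    rw [div_le_iff₀' hf0] at h2
    refine ⟨le_trans ?_ h1, h2.trans ?_⟩
    · rw [hm, hX, inv_div]
      gcongr <;> linarith
    · rw [hM, hX]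
      have : 0 < 1 - ‖x‖ := by linarith
      gcongr
      linarith
  have hXX : X⁻¹ ^ α = (X ^ α)⁻¹ := Real.inv_rpow hX0.le α
  have hXα : 1 ≤ X ^ α := Real.one_le_rpow hX1 hα
  have hmM : m ≤ M := by
    rw [hm, hM, hXX]
    gcongr
    · exact (inv_le_one_of_one_le₀ hC₀).trans hC₀
    · exact (inv_le_one_of_one_le₀ hXα).trans hXα
  have hlog : Real.log (M / m) ≤
      (2 * Real.log C₀ + 2 * α * (2 ^ (b - a) / (b - a))) * (1 - r) ^ (a - b) := by
    have hba : 0 < b - a := by linarith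
    have h1 : Real.log (M / m) = 2 * Real.log C₀ + 2 * α * Real.log X := by
      have : M / m = (C₀ * X ^ α) ^ 2 := by
        rw [hm, hM, hXX]
        field_simp
      rw [this, Real.log_pow, Real.log_mul hC₀'.ne' (by positivity), Real.log_rpow hX0]
      push_cast
      ring
    have h2 : Real.log X ≤ 2 ^ (b - a) / (b - a) * (1 - r) ^ (a - b) := by
      refine (Real.log_le_rpow_div hX0.le hba).trans_eq ?_
      rw [hX, Real.div_rpow (by norm_num) hδ.le, show a - b = -(b - a) by ring,
        Real.rpow_neg hδ.le]
      ring
    have h3 : 1 ≤ (1 - r) ^ (a - b) :=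
      Real.one_le_rpow_of_pos_of_le_one_of_nonpos hδ (by linarith) (by linarith)
    have h4 : 0 ≤ Real.log C₀ := Real.log_nonneg hC₀
    rw [h1, add_mul, mul_assoc (2 * α)]
    exact add_le_add (le_mul_of_one_le_right (by positivity) h3)
      (mul_le_mul_of_nonneg_left h2 (by positivity))
  have hu : Measurable fun y : Vec n => ENNReal.ofReal ((‖y‖ ^ n)⁻¹) := by fun_prop
  have hv : MeasurableSet {y : Vec n | ‖y‖ ∈ Icc m M} := measurable_norm measurableSet_Icc
  calc ∫⁻ x in ball (0 : Vec n) r, ENNReal.ofReal ((‖fderiv ℝ f x‖ / ‖f x‖) ^ n)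
      ≤ ∫⁻ x in ball (0 : Vec n) r, ENNReal.ofReal K *
          (ENNReal.ofReal |(fderiv ℝ f x).det| * ENNReal.ofReal ((‖f x‖ ^ n)⁻¹)) := by
        refine lintegral_mono_ae ?_
        filter_upwards [ae_restrict_of_ae_restrict_of_subset hsub hf.2.2] with x hx
        rw [← ENNReal.ofReal_mul (abs_nonneg _), ← ENNReal.ofReal_mul hK, div_pow, div_eq_mul_inv,
          ← mul_assoc]
        gcongr
        exact hx.trans (by gcongr; exact le_abs_self _)
    _ = ENNReal.ofReal K * ∫⁻ x in ball (0 : Vec n) r,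
          ENNReal.ofReal |(fderiv ℝ f x).det| * ENNReal.ofReal ((‖f x‖ ^ n)⁻¹) :=
        lintegral_const_mul' _ _ ENNReal.ofReal_ne_top
    _ ≤ ENNReal.ofReal K * (ENNReal.ofReal (C₁ / (1 - r) ^ a) *
          ∫⁻ y in {y : Vec n | ‖y‖ ∈ Icc m M}, ENNReal.ofReal ((‖y‖ ^ n)⁻¹)) := by
        gcongr
        exact lintegral_abs_det_fderiv_mul_le volume measurableSet_ball
          (fun x hx => hf.2.1 x (hsub hx)) (hmult r hr0 hr1) hu hv hmaps
    _ ≤ _ := by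
        rw [lintegral_inv_norm_pow_annulus n hn hm0 hmM, ← ENNReal.ofReal_mul (by positivity),
          ← ENNReal.ofReal_mul hK]
        refine ENNReal.ofReal_le_ofReal ?_
        calc K * (C₁ / (1 - r) ^ a *
              (n * volume.real (ball (0 : Vec n) 1) * Real.log (M / m)))
            ≤ K * (C₁ / (1 - r) ^ a * (n * volume.real (ball (0 : Vec n) 1) *
              ((2 * Real.log C₀ + 2 * α * (2 ^ (b - a) / (b - a))) * (1 - r) ^ (a - b)))) := by
              gcongr
          _ = _ := by
              rw [show -b = -a + (a - b) by ring, Real.rpow_add hδ, Real.rpow_neg hδ.le]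
              ring

/-- A weighted form of Young's inequality. -/
theorem rpow_mul_rpow_le_add {g δ q p s w : ℝ} (hg : 0 ≤ g) (hδ : 0 < δ) (hq : 0 < q)
    (hqp : q < p) :
    g ^ q * δ ^ w ≤ g ^ p * δ ^ s + δ ^ ((w - s * q / p) * (p / (p - q))) := by
  have hp : 0 < p := hq.trans hqp
  have hpq : 0 < p - q := by linarith
  set A := g ^ p * δ ^ s with hA
  set B := δ ^ ((w - s * q / p) * (p / (p - q))) with hB
  have hA0 : 0 ≤ A := by positivity
  have hB0 : 0 ≤ B := by positivity
  have hAB : g ^ q * δ ^ w = A ^ (q / p) * B ^ ((p - q) / p) := by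
    rw [hA, hB, Real.mul_rpow (by positivity) (by positivity), ← Real.rpow_mul hg,
      ← Real.rpow_mul hδ.le, ← Real.rpow_mul hδ.le, mul_assoc, ← Real.rpow_add hδ]
    congr 2 <;> field_simp
    ring
  have hqp1 : q / p ≤ 1 := (div_le_one hp).2 hqp.le
  have hpq1 : (p - q) / p ≤ 1 := (div_le_one hp).2 (by linarith)
  have hY := Real.geom_mean_le_arith_mean2_weighted (div_nonneg hq.le hp.le)
    (div_nonneg hpq.le hp.le) hA0 hB0 (by field_simp; ring)
  rw [hAB]
  exact hY.trans (add_le_add (mul_le_of_le_one_left hA0 hqp1) (mul_le_of_le_one_left hB0 hpq1))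

theorem jones_global_integral (n : ℕ) (hn : 2 ≤ n) (q K C₀ α a C₁ : ℝ)
    (hq0 : 0 < q) (hq : q < n) (hK : 1 ≤ K) (hC₀ : 1 ≤ C₀) (hα : 0 < α)
    (ha0 : 0 ≤ a) (ha : a < (n : ℝ) - 1) (hC₁ : 0 < C₁) :
    ∃ c : ℝ, 0 < c ∧ ∀ f : Vec n → Vec n,
      IsQR n K f → (∀ x ∈ unitBall n, f x ≠ 0) →
      (∀ y ∈ unitBall n,
        C₀⁻¹ * ((1 - ‖y‖) / (1 + ‖y‖)) ^ α ≤ ‖f y‖ / ‖f 0‖ ∧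
        ‖f y‖ / ‖f 0‖ ≤ C₀ * ((1 + ‖y‖) / (1 - ‖y‖)) ^ α) →
      (∀ r : ℝ, 0 < r → r < 1 → ∀ y : Vec n,
        (({z ∈ Metric.ball (0 : Vec n) r | f z = y}).encard : ℝ≥0∞) ≤
          ENNReal.ofReal (C₁ / (1 - r) ^ a)) →
      ∫⁻ x in unitBall n,
          ENNReal.ofReal ((‖fderiv ℝ f x‖ / ‖f x‖) ^ q * (1 - ‖x‖) ^ (q - 1)) ≤
        ENNReal.ofReal c := by
  have hn1 : 1 ≤ n := by omega
  have hnq : 0 < (n : ℝ) - q := by linarith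
  obtain ⟨b, hab, hb⟩ := exists_between ha
  obtain ⟨s, hbs, hs⟩ := exists_between hb
  have hs0 : 0 ≤ s := by linarith
  set β : ℝ := (q - 1 - s * q / n) * (n / (n - q)) with hβ
  have hβ1 : -1 < β := by
    have h1 : β = ((q - 1) * n - s * q) / (n - q) := by
      rw [hβ]
      field_simp
    rw [h1, lt_div_iff₀ hnq]
    nlinarith
  set C : ℝ := K * C₁ * (n * volume.real (ball (0 : Vec n) 1)) *
    (2 * Real.log C₀ + 2 * α * (2 ^ (b - a) / (b - a))) with hC
  have hC0 : 0 ≤ C := by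
    have : 0 < b - a := by linarith
    have := Real.log_nonneg hC₀
    positivity
  set c : ℝ≥0∞ := ENNReal.ofReal (C * 2 ^ b * (1 - 2 ^ (b - s))⁻¹) +
    ∫⁻ x in unitBall n, ENNReal.ofReal ((1 - ‖x‖) ^ β) with hc
  have hfin : c ≠ ∞ :=
    ENNReal.add_ne_top.2 ⟨ENNReal.ofReal_ne_top,
      (integrableOn_one_sub_norm_rpow n hn1 hβ1).lintegral_lt_top.ne⟩
  refine ⟨c.toReal + 1, by positivity, fun f hf hf0 hmin hmult => ?_⟩
  refine le_trans ?_ (ENNReal.ofReal_le_ofReal (le_add_of_nonneg_right zero_le_one))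
  rw [ENNReal.ofReal_toReal hfin]
  calc ∫⁻ x in unitBall n,
        ENNReal.ofReal ((‖fderiv ℝ f x‖ / ‖f x‖) ^ q * (1 - ‖x‖) ^ (q - 1))
      ≤ ∫⁻ x in unitBall n, (ENNReal.ofReal ((‖fderiv ℝ f x‖ / ‖f x‖) ^ n) *
          ENNReal.ofReal ((1 - ‖x‖) ^ s) + ENNReal.ofReal ((1 - ‖x‖) ^ β)) := by
        refine setLIntegral_mono' measurableSet_ball fun x hx => ?_
        have hδ : 0 < 1 - ‖x‖ := by linarith [mem_ball_zero_iff.1 hx]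
        rw [← ENNReal.ofReal_mul (by positivity), ← ENNReal.ofReal_add (by positivity)
          (by positivity), ← Real.rpow_natCast]
        exact ENNReal.ofReal_le_ofReal (rpow_mul_rpow_le_add (by positivity) hδ hq0 hq)
    _ = (∫⁻ x in unitBall n, ENNReal.ofReal ((‖fderiv ℝ f x‖ / ‖f x‖) ^ n) *
          ENNReal.ofReal ((1 - ‖x‖) ^ s)) +
          ∫⁻ x in unitBall n, ENNReal.ofReal ((1 - ‖x‖) ^ β) :=
        lintegral_add_right _ (by fun_prop)
    _ ≤ c := by
        rw [hc]
        gcongr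
        exact lintegral_mul_one_sub_norm_rpow_le volume hC0 hs0 hbs fun r hr0 hr1 =>
          hf.lintegral_log_energy_le hn1 (by linarith) hC₀ hα.le hC₁.le hab
            (hf0 0 (mem_ball_self one_pos)) hmin hmult hr0 hr1

end
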